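/- Let β > 0, ε ∈ ℝ and d ≥ 1. There exists a constant C < ∞ depending only on β and ε such that for all φ, ξ ∈ ℝ^d with (φ,ξ) ≠ (0,0) and all real s ≤ t, one has max(W(t,φ,ξ)^ε, W(s,φ,ξ)^ε) · K(t,s,φ,ξ) ≤ C · min(W(t,φ,ξ)^ε, W(s,φ,ξ)^ε). -/

import Mathlib

open MeasureTheory Real

/-- The weight `W(t,φ,ξ) = max(‖ξ - tφ‖, ‖φ‖^{1/(1+2β)})`. -/
noncomputable def Wgt (β : ℝ) {d : ℕ} (t : ℝ) (φ ξ : EuclideanSpace ℝ (Fin d)) : ℝ :=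
  max ‖ξ - t • φ‖ (‖φ‖ ^ (1 / (1 + 2 * β)))

/-- The Kolmogorov kernel `K(t,s,φ,ξ) = exp(-∫_s^t ‖ξ - τφ‖^{2β} dτ)`. -/
noncomputable def Kker (β : ℝ) {d : ℕ} (t s : ℝ) (φ ξ : EuclideanSpace ℝ (Fin d)) : ℝ :=
  Real.exp (-(∫ τ in s..t, ‖ξ - τ • φ‖ ^ (2 * β)))

theorem Wgt_pos (β : ℝ) {d : ℕ} (t : ℝ) {φ ξ : EuclideanSpace ℝ (Fin d)}
    (h : (φ, ξ) ≠ (0, 0)) : 0 < Wgt β t φ ξ := by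
  unfold Wgt
  by_cases hφ : φ = 0
  · have hξ : ξ ≠ 0 := fun hξ => h (by rw [hφ, hξ])
    refine lt_max_of_lt_left ?_
    simpa [hφ] using hξ
  · exact lt_max_of_lt_right (Real.rpow_pos_of_pos (norm_pos_iff.mpr hφ) _)

theorem Wgt_le_add (β : ℝ) {d : ℕ} (p q : ℝ) (φ ξ : EuclideanSpace ℝ (Fin d)) :
    Wgt β p φ ξ ≤ Wgt β q φ ξ + |p - q| * ‖φ‖ := by
  have h0 : 0 ≤ |p - q| * ‖φ‖ := by positivity
  have h1 : ‖ξ - q • φ‖ ≤ Wgt β q φ ξ := le_max_left _ _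
  have h2 : ‖φ‖ ^ (1 / (1 + 2 * β)) ≤ Wgt β q φ ξ := le_max_right _ _
  refine max_le ?_ (by linarith)
  have h3 : ξ - p • φ = (ξ - q • φ) - (p - q) • φ := by module
  have h4 := norm_sub_le (ξ - q • φ) ((p - q) • φ)
  rw [← h3, norm_smul, Real.norm_eq_abs] at h4
  linarith

theorem norm_le_Wgt_rpow {β : ℝ} (hβ : 0 < β) {d : ℕ} (q : ℝ)
    (φ ξ : EuclideanSpace ℝ (Fin d)) : ‖φ‖ ≤ Wgt β q φ ξ ^ (1 + 2 * β) := by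
  have h2 : ‖φ‖ ^ (1 / (1 + 2 * β)) ≤ Wgt β q φ ξ := le_max_right _ _
  have hb : (1 + 2 * β) ≠ 0 := by positivity
  calc ‖φ‖ = (‖φ‖ ^ (1 / (1 + 2 * β))) ^ (1 + 2 * β) := by
        rw [← Real.rpow_mul (norm_nonneg _), one_div_mul_cancel hb, Real.rpow_one]
    _ ≤ _ := Real.rpow_le_rpow (by positivity) h2 (by positivity)

theorem continuous_norm_sub_smul_rpow {β : ℝ} (hβ : 0 < β) {d : ℕ}
    (φ ξ : EuclideanSpace ℝ (Fin d)) : Continuous fun τ : ℝ => ‖ξ - τ • φ‖ ^ (2 * β) :=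
  Continuous.rpow_const (by fun_prop) fun _ => Or.inr (by positivity)

theorem length_mul_le_integral {f : ℝ → ℝ} (hf : Continuous f) (hf0 : ∀ x, 0 ≤ f x)
    {s u v t c : ℝ} (hsu : s ≤ u) (huv : u ≤ v) (hvt : v ≤ t)
    (hc : ∀ x ∈ Set.Icc u v, c ≤ f x) : (v - u) * c ≤ ∫ x in s..t, f x := by
  calc (v - u) * c = ∫ _ in u..v, c := by simp
    _ ≤ ∫ x in u..v, f x :=
        intervalIntegral.integral_mono_on huv (by simp) (hf.intervalIntegrable _ _) hc
    _ ≤ ∫ x in s..t, f x :=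
        intervalIntegral.integral_mono_interval hsu huv hvt
          (Filter.Eventually.of_forall hf0) (hf.intervalIntegrable _ _)

/-- If the weight at one endpoint is at least twice the weight at the other endpoint, then the
exponent of the kernel controls the ratio of the two weights. -/
theorem Wgt_div_le_integral {β : ℝ} (hβ : 0 < β) {d : ℕ} {φ ξ : EuclideanSpace ℝ (Fin d)}
    (h : (φ, ξ) ≠ (0, 0)) {s t p q : ℝ} (hst : s ≤ t)
    (hpq : p = s ∧ q = t ∨ p = t ∧ q = s) (hW : 2 * Wgt β q φ ξ ≤ Wgt β p φ ξ) :
    Wgt β p φ ξ / (2 * Wgt β q φ ξ) ≤ ∫ τ in s..t, ‖ξ - τ • φ‖ ^ (2 * β) := by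
  have hm := Wgt_pos β q h
  have hadd := Wgt_le_add β p q φ ξ
  have hφm := norm_le_Wgt_rpow hβ q φ ξ
  have hMdef : Wgt β p φ ξ = ‖ξ - p • φ‖ := by
    have h2 : ‖φ‖ ^ (1 / (1 + 2 * β)) ≤ Wgt β q φ ξ := le_max_right _ _
    rcases max_choice ‖ξ - p • φ‖ (‖φ‖ ^ (1 / (1 + 2 * β))) with h' | h'
    · exact h'
    · have : Wgt β p φ ξ = ‖φ‖ ^ (1 / (1 + 2 * β)) := h'
      linarith
  set M := Wgt β p φ ξ
  set m := Wgt β q φ ξ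
  have hM : 0 < M := by linarith
  have hφ : 0 < ‖φ‖ := by
    rcases (norm_nonneg φ).eq_or_lt with h0 | h0
    · rw [← h0] at hadd
      linarith
    · exact h0
  have habs : |p - q| = t - s := by
    rcases hpq with ⟨rfl, rfl⟩ | ⟨rfl, rfl⟩
    · rw [abs_of_nonpos (by linarith)]; ring
    · rw [abs_of_nonneg (by linarith)]
  rw [habs] at hadd
  set δ := M / 2 / ‖φ‖ with hδ
  have hδφ : δ * ‖φ‖ = M / 2 := div_mul_cancel₀ _ hφ.ne'
  have hδ0 : 0 < δ := by positivity
  have hδL : δ ≤ t - s := by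
    rw [hδ, div_le_iff₀ hφ]
    linarith
  have hlow : ∀ τ, |τ - p| ≤ δ → (M / 2) ^ (2 * β) ≤ ‖ξ - τ • φ‖ ^ (2 * β) := by
    intro τ hτ
    refine Real.rpow_le_rpow (by positivity) ?_ (by positivity)
    have h3 : ξ - p • φ = (ξ - τ • φ) + (τ - p) • φ := by module
    have h4 := norm_add_le (ξ - τ • φ) ((τ - p) • φ)
    rw [← h3, norm_smul, Real.norm_eq_abs, ← hMdef] at h4
    have h5 := mul_le_mul_of_nonneg_right hτ hφ.le
    linarith
  have hint : δ * (M / 2) ^ (2 * β) ≤ ∫ τ in s..t, ‖ξ - τ • φ‖ ^ (2 * β) := by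
    have hc := continuous_norm_sub_smul_rpow hβ φ ξ
    have h0 : ∀ τ : ℝ, 0 ≤ ‖ξ - τ • φ‖ ^ (2 * β) := fun τ => by positivity
    rcases hpq with ⟨hp, -⟩ | ⟨hp, -⟩
    · have := length_mul_le_integral hc h0 (s := s) (u := s) (v := s + δ) (t := t) le_rfl
        (by linarith) (by linarith) (fun x hx => hlow x (by
          rw [hp, abs_le]; constructor <;> linarith [hx.1, hx.2]))
      simpa using this
    · have := length_mul_le_integral hc h0 (s := s) (u := t - δ) (v := t) (t := t)
        (by linarith) (by linarith) le_rfl (fun x hx => hlow x (by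
          rw [hp, abs_le]; constructor <;> linarith [hx.1, hx.2]))
      simpa using this
  refine le_trans ?_ hint
  have hR : 1 ≤ M / (2 * m) := (one_le_div (by positivity)).mpr hW
  calc M / (2 * m) = (M / (2 * m)) ^ (1 : ℝ) := (Real.rpow_one _).symm
    _ ≤ (M / (2 * m)) ^ (1 + 2 * β) := Real.rpow_le_rpow_of_exponent_le hR (by linarith)
    _ = (M / 2) ^ (1 + 2 * β) / m ^ (1 + 2 * β) := by
        rw [← div_div, Real.div_rpow (by positivity) hm.le]
    _ ≤ (M / 2) ^ (1 + 2 * β) / ‖φ‖ := by gcongr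
    _ = δ * (M / 2) ^ (2 * β) := by
        rw [Real.rpow_add (by positivity), Real.rpow_one, hδ]; ring

theorem Kker_le_one {β : ℝ} {d : ℕ} (φ ξ : EuclideanSpace ℝ (Fin d)) {s t : ℝ} (hst : s ≤ t) :
    Kker β t s φ ξ ≤ 1 := by
  refine Real.exp_le_one_iff.mpr (neg_nonpos.mpr ?_)
  exact intervalIntegral.integral_nonneg hst fun τ _ => by positivity

theorem rpow_mul_le_of_le_exp {x K : ℝ} (a : ℝ) (hx : 1 ≤ x) (hK0 : 0 ≤ K) (hK1 : K ≤ 1)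
    (hK : 2 ≤ x → K ≤ Real.exp (-(x / 2))) :
    x ^ a * K ≤ 2 ^ ⌈|a|⌉₊ * (⌈|a|⌉₊.factorial : ℝ) := by
  set n := ⌈|a|⌉₊
  have hxa : x ^ a ≤ x ^ n := by
    rw [← Real.rpow_natCast]
    exact Real.rpow_le_rpow_of_exponent_le hx ((le_abs_self a).trans (Nat.le_ceil _))
  have hfac : (1 : ℝ) ≤ n.factorial := by exact_mod_cast n.factorial_pos
  refine (mul_le_mul_of_nonneg_right hxa hK0).trans ?_
  rcases le_total x 2 with h2 | h2
  · calc x ^ n * K ≤ 2 ^ n * 1 := by gcongr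
      _ ≤ _ := by gcongr
  · have he := Real.pow_div_factorial_le_exp (x / 2) (by positivity) n
    rw [div_le_iff₀ (by positivity), div_pow, div_le_iff₀ (by positivity)] at he
    calc x ^ n * K ≤ (Real.exp (x / 2) * n.factorial * 2 ^ n) * Real.exp (-(x / 2)) := by
          gcongr
          exact hK h2
      _ = 2 ^ n * n.factorial * (Real.exp (x / 2) * Real.exp (-(x / 2))) := by ring
      _ = 2 ^ n * n.factorial := by rw [← Real.exp_add]; simp

theorem rpow_mul_le_mul_rpow {x y K : ℝ} (ε : ℝ) (hx : 0 < x) (hy : 0 < y) (hK0 : 0 ≤ K)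
    (hK1 : K ≤ 1) (hxy : 2 * y ≤ x → K ≤ Real.exp (-(x / (2 * y))))
    (hyx : 2 * x ≤ y → K ≤ Real.exp (-(y / (2 * x)))) :
    x ^ ε * K ≤ 2 ^ ⌈|ε|⌉₊ * (⌈|ε|⌉₊.factorial : ℝ) * y ^ ε := by
  have hyε : 0 < y ^ ε := Real.rpow_pos_of_pos hy ε
  rw [← div_le_iff₀ hyε, mul_div_right_comm, ← Real.div_rpow hx.le hy.le]
  rcases le_total y x with h | h
  · refine rpow_mul_le_of_le_exp ε ((one_le_div hy).mpr h) hK0 hK1 fun h2 => ?_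
    rw [div_div, mul_comm y]
    exact hxy ((le_div_iff₀ hy).mp h2)
  · rw [← inv_div, Real.inv_rpow (by positivity), ← Real.rpow_neg (by positivity), ← abs_neg]
    refine rpow_mul_le_of_le_exp (-ε) ((one_le_div hx).mpr h) hK0 hK1 fun h2 => ?_
    rw [div_div, mul_comm x]
    exact hyx ((le_div_iff₀ hx).mp h2)

/-- Estimate (2.14): for `β > 0` and `ε ∈ ℝ` there is a constant `C < ∞` depending only
on `β` and `ε` such that for all `(φ,ξ) ≠ (0,0)` and `s ≤ t`,
`max(W(t)^ε, W(s)^ε) K(t,s) ≤ C min(W(t)^ε, W(s)^ε)`. -/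
theorem kernel_weight_swap (β ε : ℝ) (hβ : 0 < β) :
    ∃ C : ℝ,
      ∀ (d : ℕ), 1 ≤ d → ∀ φ ξ : EuclideanSpace ℝ (Fin d), (φ, ξ) ≠ (0, 0) →
        ∀ s t : ℝ, s ≤ t →
          max (Wgt β t φ ξ ^ ε) (Wgt β s φ ξ ^ ε) * Kker β t s φ ξ
            ≤ C * min (Wgt β t φ ξ ^ ε) (Wgt β s φ ξ ^ ε) := by
  refine ⟨2 ^ ⌈|ε|⌉₊ * (⌈|ε|⌉₊.factorial : ℝ), fun d _ φ ξ h s t hst => ?_⟩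
  have hK0 : 0 ≤ Kker β t s φ ξ := (Real.exp_pos _).le
  have hK1 := Kker_le_one (β := β) φ ξ hst
  have hs := Wgt_pos β s h
  have ht := Wgt_pos β t h
  have hts : 2 * Wgt β s φ ξ ≤ Wgt β t φ ξ →
      Kker β t s φ ξ ≤ Real.exp (-(Wgt β t φ ξ / (2 * Wgt β s φ ξ))) := fun hW =>
    Real.exp_le_exp.mpr (neg_le_neg (Wgt_div_le_integral hβ h hst (Or.inr ⟨rfl, rfl⟩) hW))
  have hst' : 2 * Wgt β t φ ξ ≤ Wgt β s φ ξ →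
      Kker β t s φ ξ ≤ Real.exp (-(Wgt β s φ ξ / (2 * Wgt β t φ ξ))) := fun hW =>
    Real.exp_le_exp.mpr (neg_le_neg (Wgt_div_le_integral hβ h hst (Or.inl ⟨rfl, rfl⟩) hW))
  have hself : ∀ w : ℝ, 0 < w → 2 * w ≤ w → Kker β t s φ ξ ≤ Real.exp (-(w / (2 * w))) :=
    fun w hw hw2 => by linarith
  rcases max_choice (Wgt β t φ ξ ^ ε) (Wgt β s φ ξ ^ ε) with h1 | h1 <;>
    rcases min_choice (Wgt β t φ ξ ^ ε) (Wgt β s φ ξ ^ ε) with h2 | h2 <;> rw [h1, h2]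
  · exact rpow_mul_le_mul_rpow ε ht ht hK0 hK1 (hself _ ht) (hself _ ht)
  · exact rpow_mul_le_mul_rpow ε ht hs hK0 hK1 hts hst'
  · exact rpow_mul_le_mul_rpow ε hs ht hK0 hK1 hst' hts
  · exact rpow_mul_le_mul_rpow ε hs hs hK0 hK1 (hself _ hs) (hself _ hs)
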